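/- Let (φ_i)_{i≥0} and (ϕ_i)_{i≥0} be positive sequences and σ_1, …, σ_l > 0 (l ≥ 1 fixed) satisfying: lim_{i→∞} i(1 − φ_{i−1}/φ_i) = φ for a constant φ ∈ R, lim_{i→∞} ϕ_i = 0, and lim_{i→∞} iϕ_i = ṽ ∈ (0, ∞] (interpreting φ/ṽ = 0 when ṽ = ∞). Let (η_i)_{i≥0} be a positive sequence with lim_{i→∞} η_i/ϕ_i = 1. If Σ_{k=1}^l σ_k/2 + φ/ṽ > 0, then there exists a constant c > 0 independent of t such that for all sufficiently large t: ∏_{i=0}^t ∏_{k=1}^l |1 − η_i σ_k| + Σ_{i=0}^t [∏_{j=i+1}^t ∏_{k=1}^l |1 − η_j σ_k|] ϕ_i φ_i ≤ c·φ_t/(Σ_{k=1}^l σ_k/2 + φ/ṽ). -/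

import Mathlib

open Filter
open scoped ENNReal

/-- The relative decay of `x ↦ ∏ k, |1 - x * σ k|` along a sequence tending to `0`. -/
lemma tendsto_one_sub_prod_abs_div {ι : Type*} [Fintype ι] (σ : ι → ℝ) {η : ℕ → ℝ}
    (hη : Tendsto η atTop (nhds 0)) (hη0 : ∀ i, η i ≠ 0) :
    Tendsto (fun i => (1 - ∏ k, |1 - η i * σ k|) / η i) atTop (nhds (∑ k, σ k)) := by
  classical
  have hderiv : HasDerivAt (fun x : ℝ => ∏ k, (1 - x * σ k)) (-∑ k, σ k) 0 := by
    have h := HasDerivAt.fun_finsetProd (u := Finset.univ) (x := (0 : ℝ))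
      (f := fun k x => 1 - x * σ k) (f' := fun k => -σ k)
      fun k _ => by simpa using ((hasDerivAt_id (0 : ℝ)).mul_const (σ k)).const_sub 1
    simpa using h
  have hslope := (hasDerivAt_iff_tendsto_slope.mp hderiv).comp
    (tendsto_nhdsWithin_iff.mpr ⟨hη, Eventually.of_forall hη0⟩)
  have hpos : ∀ᶠ i in atTop, ∀ k, 0 < 1 - η i * σ k := by
    refine eventually_all.mpr fun k => ?_
    have h : Tendsto (fun i => 1 - η i * σ k) atTop (nhds 1) := by
      simpa using (hη.mul_const (σ k)).const_sub 1
    exact h.eventually (lt_mem_nhds one_pos)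
  have hneg := hslope.neg
  rw [neg_neg] at hneg
  refine hneg.congr' ?_
  filter_upwards [hpos] with i hi
  simp only [Function.comp_apply, slope_def_field, zero_mul, sub_zero, Finset.prod_const_one,
    abs_of_pos (hi _)]
  ring

/-- A limit in `[0, ∞]` gives a real limit of the reciprocals, with `1 / ∞ = 0`. -/
lemma tendsto_inv_of_tendsto_ofReal {x : ℕ → ℝ} {v : ℝ≥0∞} (hx : ∀ᶠ i in atTop, 0 < x i)
    (hv : v ≠ 0) (h : Tendsto (fun i => ENNReal.ofReal (x i)) atTop (nhds v)) :
    Tendsto (fun i => (x i)⁻¹) atTop (nhds v⁻¹.toReal) := by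
  refine ((ENNReal.tendsto_toReal (ENNReal.inv_ne_top.mpr hv)).comp
    (tendsto_inv_iff.mpr h)).congr' ?_
  filter_upwards [hx] with i hi
  simp [ENNReal.toReal_inv, ENNReal.toReal_ofReal hi.le]

/-- A sequence with `B (t + 1) = q (t + 1) * B t + w (t + 1)` is eventually bounded when the
contraction `1 - q` dominates a multiple of the nonnegative forcing `w`. -/
lemma exists_bound_of_contracting_recursion {B q w : ℕ → ℝ} {δ : ℝ} (hδ : 0 < δ)
    (hq : ∀ i, 0 ≤ q i) (hw : ∀ i, 0 ≤ w i) (hB : ∀ t, B (t + 1) = q (t + 1) * B t + w (t + 1))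
    (hcontr : ∀ᶠ i in atTop, δ * w i ≤ 1 - q i) :
    ∃ M : ℝ, 0 < M ∧ ∀ᶠ t in atTop, B t ≤ M := by
  obtain ⟨N, hN⟩ := eventually_atTop.mp hcontr
  have hM : δ⁻¹ ≤ max (B N) δ⁻¹ := le_max_right _ _
  have hMpos : 0 < max (B N) δ⁻¹ := (inv_pos.mpr hδ).trans_le hM
  refine ⟨max (B N) δ⁻¹, hMpos, eventually_atTop.mpr ⟨N, fun t ht => ?_⟩⟩
  induction t, ht using Nat.le_induction with
  | base => exact le_max_left _ _
  | succ t ht ih =>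
    have hδM : 1 ≤ δ * max (B N) δ⁻¹ := by
      simpa [hδ.ne'] using mul_le_mul_of_nonneg_left hM hδ.le
    rw [hB]
    nlinarith [mul_le_mul_of_nonneg_left ih (hq (t + 1)),
      mul_le_mul_of_nonneg_right (hN (t + 1) (by omega)) hMpos.le,
      mul_le_mul_of_nonneg_left hδM (hw (t + 1))]

/-- The perturbed-product series satisfies a first-order linear recursion. -/
lemma prod_add_sum_prod_mul_succ (P a : ℕ → ℝ) (t : ℕ) :
    (∏ i ∈ Finset.range (t + 1 + 1), P i) +
        ∑ i ∈ Finset.range (t + 1 + 1), (∏ j ∈ Finset.Icc (i + 1) (t + 1), P j) * a i =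
      P (t + 1) * ((∏ i ∈ Finset.range (t + 1), P i) +
        ∑ i ∈ Finset.range (t + 1), (∏ j ∈ Finset.Icc (i + 1) t, P j) * a i) + a (t + 1) := by
  rw [Finset.prod_range_succ, Finset.sum_range_succ _ (t + 1),
    Finset.Icc_eq_empty_of_lt (Nat.lt_succ_self (t + 1)), Finset.prod_empty, mul_add,
    Finset.mul_sum]
  have h : ∀ i ∈ Finset.range (t + 1), (∏ j ∈ Finset.Icc (i + 1) (t + 1), P j) * a i =
      P (t + 1) * ((∏ j ∈ Finset.Icc (i + 1) t, P j) * a i) := fun i hi => by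
    rw [Finset.prod_Icc_succ_top (by have := Finset.mem_range.mp hi; omega)]
    ring
  rw [Finset.sum_congr rfl h]
  ring

/-- **Perturbed-product series bound** (Lemma A.4 of the paper).
Let `(φ_i)`, `(ϕ_i)` be positive sequences and `σ_1, …, σ_l > 0` with
`i (1 − φ_{i-1}/φ_i) → φ`, `ϕ_i → 0`, `i ϕ_i → ṽ ∈ (0, ∞]` (`φ/ṽ := 0` if `ṽ = ∞`),
and let `(η_i)` be positive with `η_i/ϕ_i → 1`.  If `∑_k σ_k/2 + φ/ṽ > 0`, then there is a
constant `c > 0` independent of `t` such that for all large `t`,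
`∏_{i=0}^t ∏_k |1 − η_i σ_k| + ∑_{i=0}^t ∏_{j=i+1}^t ∏_k |1 − η_j σ_k| ϕ_i φ_i
  ≤ c φ_t / (∑_k σ_k/2 + φ/ṽ)`. -/
theorem perturbed_series_bound (φse ϕse η : ℕ → ℝ) (l : ℕ) (hl : 1 ≤ l) (σ : Fin l → ℝ)
    (φ : ℝ) (vtil : ℝ≥0∞)
    (hφpos : ∀ i, 0 < φse i) (hϕpos : ∀ i, 0 < ϕse i) (hηpos : ∀ i, 0 < η i)
    (hσ : ∀ k, 0 < σ k)
    (hφ : Tendsto (fun i : ℕ => (i : ℝ) * (1 - φse (i - 1) / φse i)) atTop (nhds φ))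
    (hϕ0 : Tendsto ϕse atTop (nhds 0))
    (hvtil : 0 < vtil)
    (hiϕ : Tendsto (fun i : ℕ => ENNReal.ofReal ((i : ℝ) * ϕse i)) atTop (nhds vtil))
    (hη : Tendsto (fun i => η i / ϕse i) atTop (nhds 1))
    (hcond : 0 < (∑ k, σ k) / 2 + φ * vtil⁻¹.toReal) :
    ∃ c : ℝ, 0 < c ∧ ∀ᶠ t : ℕ in atTop,
      (∏ i ∈ Finset.range (t + 1), ∏ k, |1 - η i * σ k|) +
        ∑ i ∈ Finset.range (t + 1),
          (∏ j ∈ Finset.Icc (i + 1) t, ∏ k, |1 - η j * σ k|) * (ϕse i * φse i)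
      ≤ c * (φse t / ((∑ k, σ k) / 2 + φ * vtil⁻¹.toReal)) := by
  have hη0 : Tendsto η atTop (nhds 0) := by
    have h := hη.mul hϕ0
    rw [one_mul] at h
    exact h.congr fun i => div_mul_cancel₀ _ (hϕpos i).ne'
  set P : ℕ → ℝ := fun i => ∏ k, |1 - η i * σ k|
  have hPdiv : Tendsto (fun i => (1 - P i) / ϕse i) atTop (nhds (∑ k, σ k)) := by
    have h := (tendsto_one_sub_prod_abs_div σ hη0 fun i => (hηpos i).ne').mul hη
    rw [mul_one] at h
    exact h.congr fun i => div_mul_div_cancel₀ (hηpos i).ne'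
  have hP1 : Tendsto P atTop (nhds 1) := by
    have h := (hPdiv.mul hϕ0).const_sub 1
    rw [mul_zero, sub_zero] at h
    refine h.congr fun i => ?_
    rw [div_mul_cancel₀ _ (hϕpos i).ne', sub_sub_cancel]
  have hinv := tendsto_inv_of_tendsto_ofReal (x := fun i : ℕ => (i : ℝ) * ϕse i)
    ((eventually_gt_atTop 0).mono fun i hi => mul_pos (Nat.cast_pos.mpr hi) (hϕpos i))
    hvtil.ne' hiϕ
  have hrate : Tendsto (fun i => (1 - P i * (φse (i - 1) / φse i)) / ϕse i) atTop
      (nhds ((∑ k, σ k) + φ * vtil⁻¹.toReal)) := by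
    have h := hPdiv.add (hP1.mul (hφ.mul hinv))
    rw [one_mul] at h
    refine h.congr' ?_
    filter_upwards [eventually_gt_atTop 0] with i hi
    have hi' : (i : ℝ) ≠ 0 := Nat.cast_ne_zero.mpr hi.ne'
    have hϕi := (hϕpos i).ne'
    field_simp
    ring
  have hS : 0 ≤ ∑ k, σ k := Finset.sum_nonneg fun k _ => (hσ k).le
  obtain ⟨δ, hδ, hδlt⟩ := exists_between
    (show 0 < (∑ k, σ k) + φ * vtil⁻¹.toReal by linarith)
  have hP0 : ∀ i, 0 ≤ P i := fun i => Finset.prod_nonneg fun k _ => abs_nonneg _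
  obtain ⟨M, hM, hbound⟩ := exists_bound_of_contracting_recursion
    (B := fun t => ((∏ i ∈ Finset.range (t + 1), P i) + ∑ i ∈ Finset.range (t + 1),
      (∏ j ∈ Finset.Icc (i + 1) t, P j) * (ϕse i * φse i)) / φse t)
    (q := fun i => P i * (φse (i - 1) / φse i)) hδ
    (fun i => mul_nonneg (hP0 i) (div_pos (hφpos _) (hφpos i)).le) (fun i => (hϕpos i).le)
    (fun t => by
      have ht := (hφpos t).ne'
      have ht' := (hφpos (t + 1)).ne'
      simp only [Nat.add_sub_cancel, prod_add_sum_prod_mul_succ P fun i => ϕse i * φse i]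
      field_simp)
    ((hrate.eventually (lt_mem_nhds hδlt)).mono fun i hi => ((lt_div_iff₀ (hϕpos i)).mp hi).le)
  refine ⟨M * ((∑ k, σ k) / 2 + φ * vtil⁻¹.toReal), mul_pos hM hcond, ?_⟩
  filter_upwards [hbound] with t ht
  rw [mul_assoc, mul_div_cancel₀ _ hcond.ne']
  exact (div_le_iff₀ (hφpos t)).mp ht
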